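/- arXiv:1402.7092 — 7 statements merged into one kernel-verified Lean document; each statement's English description precedes it below -/
import Mathlib

section
/- The conditions of Theorem 1 are not necessary: for every real α with −1 < α < 0 and every real β > 0, the degree-2 generalized Bessel polynomial B_2(s, α, β) = s² + (2(α+1)/β) s + (α+1)(α+2)/β² is Hurwitz, i.e., both of its complex roots have strictly negative real part. -/
/-- A monic real quadratic with positive coefficients is Hurwitz. -/
theorem Complex.re_neg_of_quadratic_eq_zero {p q : ℝ} (hp : 0 < p) (hq : 0 < q) {z : ℂ}
    (hz : z ^ 2 + (p : ℂ) * z + (q : ℂ) = 0) : z.re < 0 := by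
  have hre := congrArg Complex.re hz
  have him := congrArg Complex.im hz
  simp only [pow_two, Complex.add_re, Complex.mul_re, Complex.ofReal_re, Complex.ofReal_im,
    Complex.zero_re, Complex.add_im, Complex.mul_im, Complex.zero_im] at hre him
  have hprod : z.im * (2 * z.re + p) = 0 := by linarith
  rcases mul_eq_zero.mp hprod with h | h
  · rw [h] at hre
    by_contra! hx
    nlinarith [mul_nonneg hp.le hx, mul_self_nonneg z.re]
  · linarith

/-- for `−1 < α < 0` and `β > 0`, the degree-2 generalized Bessel polynomial
`B_2(s, α, β) = s² + (2(α+1)/β) s + (α+1)(α+2)/β²` is Hurwitz: both complex roots have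
strictly negative real part. Hence the conditions of Theorem 1 are not necessary. -/
theorem gbp_two_hurwitz_neg_alpha (α β : ℝ) (hα₁ : -1 < α) (hα₂ : α < 0) (hβ : 0 < β) :
    ∀ z : ℂ, z ^ 2 + (2 * ((α : ℂ) + 1) / (β : ℂ)) * z
        + ((α : ℂ) + 1) * ((α : ℂ) + 2) / (β : ℂ) ^ 2 = 0 → z.re < 0 := by
  intro z hz
  have hp : 0 < 2 * (α + 1) / β := div_pos (by linarith) hβ
  have hq : 0 < (α + 1) * (α + 2) / β ^ 2 :=
    div_pos (mul_pos (by linarith) (by linarith)) (pow_pos hβ 2)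
  exact Complex.re_neg_of_quadratic_eq_zero hp hq (by exact_mod_cast hz)
end

section
/- (Theorem 2, numerator) For all natural numbers n and m, the numerator polynomial of the (n,m) Padé approximant of e^{−s} is a generalized Bessel polynomial: Q_{nm}(s) = (n!/(n+m)!) · B_m(−s, δ, 1) with δ = n − m + 2, as an identity of polynomials in s with real coefficients. -/
open Polynomial Finset Nat

/-- The generalized Bessel polynomial `B_n(s, α, β)` as a real polynomial in `s`. -/
noncomputable def GBP (n : ℕ) (α β : ℝ) : Polynomial ℝ :=
  ∑ k ∈ Finset.range (n + 1),
    Polynomial.C ((n.choose k : ℝ) * (descPochhammer ℝ k).eval ((n : ℝ) + k + α - 2) * β⁻¹ ^ k) *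
      Polynomial.X ^ (n - k)

/-- Numerator polynomial `Q_{nm}` of the `(n,m)` Padé approximant of `e^{−s}`. -/
noncomputable def padeQ (n m : ℕ) : Polynomial ℝ :=
  Polynomial.C ((n ! : ℝ) / ((n + m)! : ℝ)) *
    ∑ k ∈ Finset.range (m + 1),
      Polynomial.C ((m.choose k : ℝ) * (((n + k)! : ℝ) / (n ! : ℝ))) * (-Polynomial.X) ^ (m - k)

/-- Denominator polynomial `P_{nm}` of the `(n,m)` Padé approximant of `e^{−s}`. -/
noncomputable def padeP (n m : ℕ) : Polynomial ℝ :=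
  Polynomial.C ((m ! : ℝ) / ((n + m)! : ℝ)) *
    ∑ k ∈ Finset.range (n + 1),
      Polynomial.C ((n.choose k : ℝ) * (((m + k)! : ℝ) / (m ! : ℝ))) * Polynomial.X ^ (n - k)

/-- The falling factorial of order `k` at `n + k` equals `(n + k)! / n!`. -/
theorem descPochhammer_eval_add_eq_factorial_div (n k : ℕ) :
    (descPochhammer ℝ k).eval ((n : ℝ) + k) = ((n + k)! : ℝ) / (n ! : ℝ) := by
  rw [← Nat.cast_add, descPochhammer_eval_eq_descFactorial,
    eq_div_iff (Nat.cast_ne_zero.mpr n.factorial_ne_zero), mul_comm]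
  have h := Nat.factorial_mul_descFactorial (Nat.le_add_left k n)
  rw [Nat.add_sub_cancel] at h
  exact_mod_cast h

/-- Theorem 2, numerator: `Q_{nm}(s) = (n!/(n+m)!) · B_m(−s, δ, 1)` with
`δ = n − m + 2`, as an identity of real polynomials in `s`. -/
theorem padeQ_eq_gbp (n m : ℕ) :
    padeQ n m =
      Polynomial.C ((n ! : ℝ) / ((n + m)! : ℝ)) *
        (GBP m ((n : ℝ) - (m : ℝ) + 2) 1).comp (-Polynomial.X) := by
  unfold padeQ GBP
  congr 1
  rw [Polynomial.sum_comp]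
  refine Finset.sum_congr rfl fun k _ => ?_
  have h : (m : ℝ) + k + ((n : ℝ) - m + 2) - 2 = n + k := by ring
  simp only [h, descPochhammer_eval_add_eq_factorial_div, inv_one, one_pow, mul_one,
    Polynomial.mul_comp, Polynomial.C_comp, Polynomial.X_pow_comp]
end

section
/- (Theorem 3) For all natural numbers n ≥ 1 and m with m ≥ n − 2, the (n,m) Padé approximant of e^{−s} is stable; that is, the denominator polynomial P_{nm}(s) is Hurwitz: every complex root z of P_{nm} satisfies Re z < 0. -/
open Polynomial Finset Nat

/-- The denominator polynomial rescaled to have integer coefficients, over `ℂ`: the polynomial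
`∑ k, C(n,k) (m+k)! X^(n-k)`, given by its recurrence in the degree. -/
noncomputable def padeDenom : ℕ → ℕ → ℂ[X]
  | 0, m => Polynomial.C (m ! : ℂ)
  | n + 1, m => Polynomial.X * padeDenom n m + padeDenom n (m + 1)

theorem padeDenom_succ (n m : ℕ) :
    padeDenom (n + 1) m = Polynomial.X * padeDenom n m + padeDenom n (m + 1) := by
  rw [padeDenom]

theorem padeDenom_eq_sum (n m : ℕ) :
    padeDenom n m =
      ∑ k ∈ Finset.range (n + 1), (n.choose k : ℂ[X]) * (((m + k)! : ℂ[X]) * X ^ (n - k)) := by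
  induction n generalizing m with
  | zero => simp [padeDenom]
  | succ n ih =>
    rw [padeDenom_succ, ih, ih,
      Finset.sum_choose_succ_mul (fun i j => ((m + i)! : ℂ[X]) * X ^ j) n, Finset.mul_sum]
    refine congrArg₂ (· + ·) ?_ ?_
    · refine Finset.sum_congr rfl fun k hk => ?_
      rw [Nat.succ_sub (Finset.mem_range_succ_iff.mp hk), pow_succ]
      ring
    · refine Finset.sum_congr rfl fun k _ => ?_
      rw [show m + 1 + k = m + (k + 1) by ring]

theorem map_padeP (n m : ℕ) :
    (padeP n m).map (algebraMap ℝ ℂ) = Polynomial.C (1 / ((n + m)! : ℂ)) * padeDenom n m := by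
  rw [padeP, padeDenom_eq_sum, Polynomial.map_mul, Polynomial.map_sum, Finset.mul_sum,
    Finset.mul_sum]
  refine Finset.sum_congr rfl fun k _ => ?_
  have hm : (m ! : ℂ) ≠ 0 := by exact_mod_cast m.factorial_ne_zero
  simp only [Polynomial.map_mul, Polynomial.map_pow, Polynomial.map_C, Polynomial.map_X,
    ← Polynomial.C_eq_natCast, ← mul_assoc, ← Polynomial.C_mul]
  congr 2
  simp only [Complex.coe_algebraMap, Complex.ofReal_div, Complex.ofReal_mul,
    Complex.ofReal_natCast]
  field_simp

theorem padeDenom_succ_succ (n m : ℕ) :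
    padeDenom (n + 1) (m + 1) =
      (m + 1) * padeDenom (n + 1) m + (n + 1) * padeDenom n (m + 1) := by
  induction n generalizing m with
  | zero =>
    simp only [padeDenom, Nat.factorial_succ]
    push_cast
    simp only [Polynomial.C_add, Polynomial.C_mul, Polynomial.C_1, Polynomial.C_eq_natCast]
    ring
  | succ n ih =>
    have h₁ := ih m
    have h₂ := ih (m + 1)
    rw [padeDenom_succ (n + 1) (m + 1), padeDenom_succ (n + 1) m]
    rw [padeDenom_succ n (m + 1)] at h₁ h₂ ⊢
    push_cast at h₂ ⊢
    linear_combination X * h₁ + h₂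

theorem derivative_padeDenom_succ (n m : ℕ) :
    derivative (padeDenom (n + 1) m) = (n + 1) * padeDenom n m := by
  induction n generalizing m with
  | zero => simp [padeDenom]
  | succ n ih =>
    rw [padeDenom_succ, derivative_add, derivative_mul, derivative_X, ih, ih,
      padeDenom_succ n m]
    push_cast
    ring

theorem eval_zero_padeDenom (n m : ℕ) : (padeDenom n m).eval 0 = ((m + n)! : ℂ) := by
  induction n generalizing m with
  | zero => simp [padeDenom]
  | succ n ih => simp [padeDenom, ih, add_assoc, add_comm 1 n]

theorem padeDenom_diag (n : ℕ) :
    padeDenom (n + 1) (n + 1) =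
      ((n : ℂ[X]) + 1) * (X * padeDenom n n + 2 * padeDenom n (n + 1)) := by
  rw [padeDenom_succ_succ, padeDenom_succ n n]
  ring

theorem padeDenom_diag_recurrence (n : ℕ) :
    padeDenom (n + 2) (n + 2) =
      ((n : ℂ[X]) + 2) * ((4 * (n : ℂ[X]) + 6) * padeDenom (n + 1) (n + 1) +
        ((n : ℂ[X]) + 1) * X ^ 2 * padeDenom n n) := by
  have h₁ := padeDenom_diag n
  have h₂ := padeDenom_diag (n + 1)
  have h₃ := padeDenom_succ_succ n (n + 1)
  have h₄ := padeDenom_succ n (n + 1)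
  push_cast at h₂ h₃
  simp only [add_assoc, Nat.reduceAdd] at h₂ h₃ h₄
  linear_combination h₂ + 2 * ((n : ℂ[X]) + 2) * h₃ - 2 * ((n : ℂ[X]) + 2) * ((n : ℂ[X]) + 1) * h₄ +
    ((n : ℂ[X]) + 2) * X * h₁

theorem padeDenom_add_two (n : ℕ) :
    2 * ((n : ℂ[X]) + 1) * padeDenom (n + 2) n =
      (2 * ((n : ℂ[X]) + 1) + X) * padeDenom (n + 1) (n + 1) +
        ((n : ℂ[X]) + 1) * X ^ 2 * padeDenom n n := by
  rw [padeDenom_succ (n + 1), padeDenom_succ n n]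
  linear_combination -X * padeDenom_diag n

theorem inv_re_nonneg {z : ℂ} (hz : 0 ≤ z.re) : 0 ≤ (z⁻¹).re := by
  rw [Complex.inv_re]
  exact div_nonneg hz (Complex.normSq_nonneg z)

theorem inv_re_pos {z : ℂ} (hz : 0 < z.re) : 0 < (z⁻¹).re := by
  rw [Complex.inv_re]
  refine div_pos hz (Complex.normSq_pos.mpr ?_)
  rintro rfl
  simp at hz

theorem padeDenom_diag_ratio {z : ℂ} (hz : 0 ≤ z.re) (hz₀ : z ≠ 0) (n : ℕ) :
    ∃ r : ℂ, 0 < r.re ∧ (padeDenom n n).eval z ≠ 0 ∧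
      (padeDenom (n + 1) (n + 1)).eval z = z * r * (padeDenom n n).eval z := by
  induction n with
  | zero =>
    refine ⟨1 + 2 * z⁻¹, ?_, by simp [padeDenom], ?_⟩
    · have := inv_re_nonneg hz
      simp only [Complex.add_re, Complex.one_re, Complex.mul_re, Complex.re_ofNat,
        Complex.im_ofNat, zero_mul, sub_zero]
      linarith
    · simp [padeDenom, Nat.factorial]
      field_simp
  | succ n ih =>
    obtain ⟨r, hr, hne, h⟩ := ih
    have hr₀ : r ≠ 0 := by
      rintro rfl
      simp at hr
    refine ⟨((n + 2 : ℝ) * (4 * n + 6) : ℝ) * z⁻¹ + ((n + 2) * (n + 1) : ℝ) * r⁻¹, ?_, ?_, ?_⟩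
    · rw [Complex.add_re, Complex.re_ofReal_mul, Complex.re_ofReal_mul]
      have h₁ := inv_re_nonneg hz
      have h₂ := inv_re_pos hr
      positivity
    · rw [h]
      exact mul_ne_zero (mul_ne_zero hz₀ hr₀) hne
    · rw [padeDenom_diag_recurrence]
      simp only [eval_mul, eval_add, eval_natCast, eval_X, eval_pow, eval_one, eval_ofNat, h]
      push_cast
      field_simp

theorem re_neg_of_padeDenom_add_two_root (m : ℕ) {z : ℂ}
    (h : (padeDenom (m + 2) m).eval z = 0) : z.re < 0 := by
  by_contra! hz
  have hz₀ : z ≠ 0 := by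
    rintro rfl
    rw [eval_zero_padeDenom] at h
    exact Nat.factorial_ne_zero _ (by exact_mod_cast h)
  obtain ⟨r, hr, hne, hD⟩ := padeDenom_diag_ratio hz hz₀ m
  have hr₀ : r ≠ 0 := by
    rintro rfl
    simp at hr
  have key := congrArg (Polynomial.eval z) (padeDenom_add_two m)
  simp only [eval_mul, eval_add, eval_natCast, eval_X, eval_pow, eval_one, eval_ofNat, h,
    hD] at key
  have hw : (2 * (m + 1) : ℝ) * z⁻¹ + 1 + ((m + 1 : ℝ) : ℂ) * r⁻¹ = 0 := by
    have hfac : z ^ 2 * r * (padeDenom m m).eval z *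
        ((2 * (m + 1) : ℝ) * z⁻¹ + 1 + ((m + 1 : ℝ) : ℂ) * r⁻¹) = 0 := by
      push_cast
      field_simp
      linear_combination -key
    exact (mul_eq_zero.mp hfac).resolve_left
      (mul_ne_zero (mul_ne_zero (pow_ne_zero 2 hz₀) hr₀) hne)
  have hre := congrArg Complex.re hw
  rw [Complex.add_re, Complex.add_re, Complex.re_ofReal_mul, Complex.re_ofReal_mul,
    Complex.one_re, Complex.zero_re] at hre
  have h₁ := inv_re_nonneg hz
  have h₂ := inv_re_pos hr
  have : 0 < 2 * (m + 1 : ℝ) * (z⁻¹).re + 1 + (m + 1 : ℝ) * (r⁻¹).re := by positivity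
  exact this.ne' hre

theorem padeDenom_ne_zero (n m : ℕ) : padeDenom n m ≠ 0 := by
  intro h
  have h₀ := eval_zero_padeDenom n m
  rw [h, eval_zero] at h₀
  exact Nat.factorial_ne_zero _ (by exact_mod_cast h₀.symm)

theorem re_neg_of_padeDenom_root_of_succ {n m : ℕ}
    (hroots : ∀ z : ℂ, (padeDenom (n + 1) m).eval z = 0 → z.re < 0)
    {z : ℂ} (h : (padeDenom n m).eval z = 0) : z.re < 0 := by
  have hder : derivative (padeDenom (n + 1) m) ≠ 0 := by
    rw [derivative_padeDenom_succ]
    exact mul_ne_zero (by exact_mod_cast n.succ_ne_zero) (padeDenom_ne_zero n m)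
  have hdeg : 0 < (padeDenom (n + 1) m).degree := by
    rw [← natDegree_pos_iff_degree_pos, Nat.pos_iff_ne_zero]
    exact fun h₀ => hder (derivative_of_natDegree_zero h₀)
  have hz : z ∈ (derivative (padeDenom (n + 1) m)).rootSet ℂ := by
    rw [mem_rootSet, coe_aeval_eq_eval]
    exact ⟨hder, by rw [derivative_padeDenom_succ, eval_mul, h, mul_zero]⟩
  refine convexHull_min ?_ (convex_halfSpace_re_lt 0)
    (rootSet_derivative_subset_convexHull_rootSet hdeg hz)
  intro w hw
  rw [mem_rootSet, coe_aeval_eq_eval] at hw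
  exact hroots w hw.2

theorem re_neg_of_padeDenom_root {n m : ℕ} (hnm : n ≤ m + 2) :
    ∀ z : ℂ, (padeDenom n m).eval z = 0 → z.re < 0 := by
  induction hnm using Nat.decreasingInduction with
  | self => exact fun z => re_neg_of_padeDenom_add_two_root m
  | of_succ n _ ih => exact fun z => re_neg_of_padeDenom_root_of_succ ih

/-- Theorem 3: for `n ≥ 1` and `m ≥ n − 2`, the `(n,m)` Padé approximant of
`e^{−s}` is stable: every complex root of `P_{nm}` has strictly negative real part. -/
theorem padeP_hurwitz (n m : ℕ) (hn : 1 ≤ n) (hm : (n : ℤ) - 2 ≤ (m : ℤ)) :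
    ∀ z : ℂ, Polynomial.aeval z (padeP n m) = 0 → z.re < 0 := by
  intro z hz
  rw [← eval_map_algebraMap, map_padeP, eval_mul, eval_C] at hz
  have hfac : (1 / ((n + m)! : ℂ)) ≠ 0 :=
    one_div_ne_zero (by exact_mod_cast (n + m).factorial_ne_zero)
  exact re_neg_of_padeDenom_root (by omega) z ((mul_eq_zero.mp hz).resolve_left hfac)
end

section
/- (Theorem 4, case m = n−1) Let n ≥ 1 and m = n − 1, let H(z) = Q_{nm}(z)/P_{nm}(z) be the (n, n−1) Padé approximant of e^{−s} viewed as a complex rational function, and let τ(ω) = −Re(H′(iω)/H(iω)) be its group delay. Then τ(0) = 1, the derivatives of τ at ω = 0 of every order 1, 2, …, 2n − 1 vanish, and the derivative of order 2n is nonzero; i.e., the delay approximation is maximally flat of order m + 1 = n. -/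
open Polynomial Finset Nat

/-- The `(n,m)` Padé approximant `H(z) = Q_{nm}(z)/P_{nm}(z)` as a complex rational function. -/
noncomputable def padeH (n m : ℕ) : ℂ → ℂ := fun z =>
  Polynomial.aeval z (padeQ n m) / Polynomial.aeval z (padeP n m)

/-- Group delay along the imaginary axis: `τ(ω) = −Re(H′(iω)/H(iω))`. -/
noncomputable def groupDelay (H : ℂ → ℂ) : ℝ → ℝ := fun ω =>
  -(deriv H ((ω : ℂ) * Complex.I) / H ((ω : ℂ) * Complex.I)).re

lemma padeP_coeff (n m j : ℕ) :
    (padeP n m).coeff j = n.choose j * (n + m - j)! / (n + m)! := by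
  have hm : (m ! : ℝ) ≠ 0 := by positivity
  simp only [padeP, coeff_C_mul, finsetSum_coeff, coeff_X_pow]
  rcases le_or_gt j n with hj | hj
  · rw [Finset.sum_eq_single (n - j)]
    · rw [if_pos (by omega), Nat.choose_symm hj, show m + (n - j) = n + m - j by omega]
      field_simp
    · intro b hb hne
      rw [Finset.mem_range] at hb
      rw [if_neg (by omega), mul_zero]
    · intro h
      exact absurd (Finset.mem_range.2 (by omega)) h
  · rw [Finset.sum_eq_zero, Nat.choose_eq_zero_of_lt hj]
    · simp
    · intro b _
      rw [if_neg (by omega), mul_zero]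

lemma padeP_coeff_zero (n m : ℕ) : (padeP n m).coeff 0 = 1 := by
  have : ((n + m)! : ℝ) ≠ 0 := by positivity
  simp [padeP_coeff, this]

lemma padeP_coeff_one {n m : ℕ} (h : 0 < n + m) : (padeP n m).coeff 1 = n / (n + m) := by
  obtain ⟨N, hN⟩ : ∃ N, n + m = N + 1 := ⟨n + m - 1, by omega⟩
  have hN' : (n : ℝ) + m = N + 1 := by exact_mod_cast hN
  have : (N ! : ℝ) ≠ 0 := by positivity
  rw [padeP_coeff, hN, hN', Nat.factorial_succ]
  push_cast
  rw [Nat.choose_one_right]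
  field_simp

lemma padeQ_eq_padeP_comp_neg_X (n m : ℕ) : padeQ n m = (padeP m n).comp (-X) := by
  simp [padeQ, padeP, add_comm]

lemma padeQ_coeff_zero (n m : ℕ) : (padeQ n m).coeff 0 = 1 := by
  rw [padeQ_eq_padeP_comp_neg_X, coeff_zero_eq_eval_zero, eval_comp]
  simp [← coeff_zero_eq_eval_zero, padeP_coeff_zero]

lemma padeQ_coeff_one {n m : ℕ} (h : 0 < n + m) : (padeQ n m).coeff 1 = -(m / (n + m)) := by
  have key : ∀ p : ℝ[X], p.coeff 1 = (derivative p).eval 0 := fun p => by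
    rw [← coeff_zero_eq_eval_zero, coeff_derivative]
    simp
  rw [padeQ_eq_padeP_comp_neg_X, key, derivative_comp]
  have := padeP_coeff_one (n := m) (m := n) (by omega)
  rw [key] at this
  simp [this, add_comm]

/-- The Kummer differential equation satisfied by the Padé denominator. -/
lemma padeP_kummer (n m : ℕ) :
    X * derivative (derivative (padeP n m)) - (C ((n : ℝ) + m) + X) * derivative (padeP n m)
      + C (n : ℝ) * padeP n m = 0 := by
  have key : ∀ j : ℕ, ((n : ℝ) - j) * (padeP n m).coeff j
      = ((n : ℝ) + m - j) * ((j + 1) * (padeP n m).coeff (j + 1)) := fun j => by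
    have hc : ((n.choose (j + 1) : ℝ)) * (j + 1) = n.choose j * ((n : ℝ) - j) := by
      rcases le_or_gt j n with hj | hj
      · have := Nat.choose_succ_right_eq n j
        rw [← Nat.cast_sub hj]
        exact_mod_cast this
      · simp [Nat.choose_eq_zero_of_lt hj, Nat.choose_eq_zero_of_lt (Nat.lt_succ_of_lt hj)]
    rw [padeP_coeff, padeP_coeff]
    rcases lt_or_ge j n with hj | hj
    · obtain ⟨d, hd⟩ : ∃ d, n + m = j + 1 + d := ⟨n + m - (j + 1), by omega⟩
      have hd' : (n : ℝ) + m = j + 1 + d := by exact_mod_cast hd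
      rw [show n + m - j = d + 1 by omega, show n + m - (j + 1) = d by omega, hd',
        Nat.factorial_succ]
      push_cast
      linear_combination (-((d : ℝ) + 1) * d ! / (n + m)!) * hc
    · rw [Nat.choose_eq_zero_of_lt (Nat.lt_succ_of_le hj)]
      rcases hj.eq_or_lt with rfl | hj
      · simp
      · simp [Nat.choose_eq_zero_of_lt hj]
  ext j
  rw [add_mul]
  rcases j with _ | j
  · have := key 0
    simp only [coeff_add, coeff_sub, coeff_C_mul, coeff_X_mul_zero, coeff_derivative, coeff_zero]
    push_cast at this ⊢
    linear_combination this
  · have := key (j + 1)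
    simp only [coeff_add, coeff_sub, coeff_C_mul, coeff_X_mul, coeff_derivative, coeff_zero]
    push_cast at this ⊢
    linear_combination this

lemma padeQ_kummer (n m : ℕ) :
    X * derivative (derivative (padeQ n m)) - (C ((n : ℝ) + m) - X) * derivative (padeQ n m)
      - C (m : ℝ) * padeQ n m = 0 := by
  have h := congrArg (fun p => p.comp (-X)) (padeP_kummer m n)
  simp only [add_comp, sub_comp, mul_comp, X_comp, C_comp, zero_comp] at h
  rw [padeQ_eq_padeP_comp_neg_X]
  simp only [derivative_comp, derivative_neg, derivative_X, neg_neg, neg_mul, one_mul]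
  rw [add_comm (n : ℝ)]
  linear_combination -h

lemma eq_C_mul_X_pow_of_X_mul_derivative {R : Type*} [CommRing R] [IsDomain R] [CharZero R]
    {p : R[X]} {N : ℕ} (h : X * derivative p = C (N : R) * p) : p = C (p.coeff N) * X ^ N := by
  ext j
  rw [coeff_C_mul_X_pow]
  split_ifs with hj
  · rw [hj]
  · have hc := congrArg (fun q => q.coeff j) h
    have : ((j : R) - N) * p.coeff j = 0 := by
      rcases j with _ | j
      · simp only [coeff_X_mul_zero, coeff_C_mul] at hc
        push_cast
        linear_combination hc
      · simp only [coeff_X_mul, coeff_C_mul, coeff_derivative] at hc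
        push_cast
        linear_combination hc
    exact (mul_eq_zero.1 this).resolve_left (sub_ne_zero.2 (Nat.cast_injective.ne hj))

lemma derivative_mul_sub_mul_derivative_add_mul_ne_zero {R : Type*} [CommRing R] [IsDomain R]
    {p q : R[X]} (hp : p ≠ 0) (hq : q ≠ 0) :
    derivative q * p - q * derivative p + q * p ≠ 0 := by
  intro h
  have h' : q * p = q * derivative p - derivative q * p := by linear_combination h
  have h1 : (q * derivative p).degree < (q * p).degree := by
    rw [degree_mul, degree_mul]
    exact WithBot.add_lt_add_left (degree_ne_bot.2 hq) (degree_derivative_lt hp)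
  have h2 : (derivative q * p).degree < (q * p).degree := by
    rw [degree_mul, degree_mul]
    exact WithBot.add_lt_add_right (degree_ne_bot.2 hp) (degree_derivative_lt hq)
  have h3 := (degree_sub_le (q * derivative p) (derivative q * p)).trans_lt (max_lt h1 h2)
  rw [← h'] at h3
  exact lt_irrefl _ h3

lemma padeP_ne_zero (n m : ℕ) : padeP n m ≠ 0 := fun h => by
  simpa [h] using padeP_coeff_zero n m

lemma padeQ_ne_zero (n m : ℕ) : padeQ n m ≠ 0 := fun h => by
  simpa [h] using padeQ_coeff_zero n m

lemma exists_pade_wronskian (n m : ℕ) : ∃ c : ℝ, c ≠ 0 ∧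
    derivative (padeQ n m) * padeP n m - padeQ n m * derivative (padeP n m)
      + padeQ n m * padeP n m = C c * X ^ (n + m) := by
  set W := derivative (padeQ n m) * padeP n m - padeQ n m * derivative (padeP n m)
      + padeQ n m * padeP n m with hW
  have hne : W ≠ 0 :=
    derivative_mul_sub_mul_derivative_add_mul_ne_zero (padeP_ne_zero n m) (padeQ_ne_zero n m)
  have h : W = C (W.coeff (n + m)) * X ^ (n + m) := by
    refine eq_C_mul_X_pow_of_X_mul_derivative ?_
    have hP := padeP_kummer n m
    have hQ := padeQ_kummer n m
    rw [hW]
    simp only [derivative_add, derivative_sub, derivative_mul, Nat.cast_add, C_add] at hP hQ ⊢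
    linear_combination padeP n m * hQ - padeQ n m * hP
  refine ⟨_, fun h0 => hne ?_, h⟩
  rw [h, h0, C_0, zero_mul]

lemma groupDelay_div_eq {P Q : ℝ[X]} {c : ℝ} {k : ℕ}
    (hW : derivative Q * P - Q * derivative P + Q * P = C c * X ^ (2 * k + 1))
    (h0 : (P * Q).coeff 0 = 1) {ω : ℝ} (hω : aeval ((ω : ℂ) * Complex.I) (P * Q) ≠ 0) :
    groupDelay (fun z => aeval z Q / aeval z P) ω = 1 + ω ^ (2 * (k + 1)) *
      ((-1) ^ (k + 1) * c * (aeval ((ω : ℂ) * Complex.I) (divX (P * Q)) /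
        aeval ((ω : ℂ) * Complex.I) (P * Q)).re) := by
  set z : ℂ := (ω : ℂ) * Complex.I with hz
  have hF : z * aeval z (divX (P * Q)) + 1 = aeval z (P * Q) := by
    conv_rhs => rw [← X_mul_divX_add (P * Q), h0]
    simp
  have hPQ : aeval z P ≠ 0 ∧ aeval z Q ≠ 0 := by
    rwa [map_mul, mul_ne_zero_iff] at hω
  obtain ⟨hP, hQ⟩ := hPQ
  have hd : deriv (fun z => aeval z Q / aeval z P) z =
      (aeval z (derivative Q) * aeval z P - aeval z Q * aeval z (derivative P)) /
        aeval z P ^ 2 :=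
    ((Q.hasDerivAt_aeval z).div (P.hasDerivAt_aeval z) hP).deriv
  have hWz : aeval z (derivative Q) * aeval z P - aeval z Q * aeval z (derivative P)
      + aeval z Q * aeval z P = c * z ^ (2 * k + 1) := by
    simpa using congrArg (aeval z) hW
  have hodd : z ^ (2 * k + 1) = ((-1) ^ k * ω ^ (2 * k + 1) : ℝ) * Complex.I := by
    rw [hz, mul_pow, pow_succ Complex.I, pow_mul Complex.I, Complex.I_sq]
    push_cast
    ring
  have heven : z ^ (2 * (k + 1)) = ((-1) ^ (k + 1) * ω ^ (2 * (k + 1)) : ℝ) := by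
    rw [hz, mul_pow, pow_mul Complex.I, Complex.I_sq]
    push_cast
    ring
  have hmain : -(deriv (fun z => aeval z Q / aeval z P) z / (aeval z Q / aeval z P)) =
      1 - c * z ^ (2 * k + 1)
        + c * z ^ (2 * (k + 1)) * (aeval z (divX (P * Q)) / aeval z (P * Q)) := by
    rw [hd, eq_sub_of_add_eq hWz]
    rw [map_mul] at hF ⊢
    field_simp
    linear_combination (-c * z ^ (2 * k + 1)) * hF
  rw [groupDelay, ← Complex.neg_re, ← hz, hmain, hodd, heven, Complex.add_re, ← Complex.ofReal_mul,
    Complex.re_ofReal_mul, Complex.sub_re, ← mul_assoc, ← Complex.ofReal_mul,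
    Complex.re_ofReal_mul]
  simp only [Complex.one_re, Complex.I_re]
  ring

lemma analyticAt_re_aeval_div_aeval {p q : ℝ[X]} (hq : q.coeff 0 ≠ 0) :
    AnalyticAt ℝ (fun ω : ℝ => (aeval ((ω : ℂ) * Complex.I) p /
      aeval ((ω : ℂ) * Complex.I) q).re) 0 := by
  have hz : AnalyticAt ℝ (fun ω : ℝ => (ω : ℂ) * Complex.I) 0 :=
    (Complex.ofRealCLM.analyticAt 0).mul analyticAt_const
  refine (Complex.reCLM.analyticAt _).comp ((hz.aeval_polynomial p).div (hz.aeval_polynomial q) ?_)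
  simpa [← coeff_zero_eq_aeval_zero'] using hq

lemma iteratedDeriv_of_eventuallyEq_add_pow_mul {f g : ℝ → ℝ} {a : ℝ} {N : ℕ}
    (hg : AnalyticAt ℝ g 0) (hg0 : g 0 ≠ 0) (hf : f =ᶠ[nhds 0] fun x => a + x ^ N * g x) :
    (∀ k, 1 ≤ k → k < N → iteratedDeriv k f 0 = 0) ∧ (1 ≤ N → iteratedDeriv N f 0 ≠ 0) := by
  have ha : AnalyticAt ℝ (fun x => x ^ N * g x) 0 := (analyticAt_id.pow N).mul hg
  have hord : analyticOrderAt (fun x => x ^ N * g x) 0 = N :=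
    ha.analyticOrderAt_eq_natCast.2 ⟨g, hg, hg0, by simp⟩
  have hzero := (natCast_le_analyticOrderAt_iff_iteratedDeriv_eq_zero ha).1 hord.ge
  have hk : ∀ k, 1 ≤ k → iteratedDeriv k f 0 = iteratedDeriv k (fun x => x ^ N * g x) 0 :=
    fun k h => by rw [hf.iteratedDeriv_eq, iteratedDeriv_const_add (by omega)]
  refine ⟨fun k h1 hN => (hk k h1).trans (hzero k hN), fun h1 h => ?_⟩
  rw [hk N h1] at h
  have hle := (natCast_le_analyticOrderAt_iff_iteratedDeriv_eq_zero (n := N + 1) ha).2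
    fun i hi => (Nat.lt_succ_iff_lt_or_eq.1 hi).elim (hzero i) fun e => e ▸ h
  rw [hord] at hle
  exact absurd (Nat.cast_le.1 hle) (by omega)

/-- Theorem 4, case `m = n−1`: the group delay `τ` of the `(n, n−1)` Padé
approximant satisfies `τ(0) = 1`, its derivatives of orders `1, …, 2n−1` vanish at `0`, and
its derivative of order `2n` is nonzero: the delay approximation is maximally flat of
order `m + 1 = n`. -/
theorem pade_delay_flat_nm1 (n : ℕ) (hn : 1 ≤ n) :
    groupDelay (padeH n (n - 1)) 0 = 1 ∧
    (∀ k : ℕ, 1 ≤ k → k ≤ 2 * n - 1 → iteratedDeriv k (groupDelay (padeH n (n - 1))) 0 = 0) ∧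
    iteratedDeriv (2 * n) (groupDelay (padeH n (n - 1))) 0 ≠ 0 := by
  obtain ⟨k, rfl⟩ : ∃ k, n = k + 1 := ⟨n - 1, by omega⟩
  rw [Nat.add_sub_cancel]
  obtain ⟨c, hc, hW⟩ := exists_pade_wronskian (k + 1) k
  rw [show k + 1 + k = 2 * k + 1 by ring] at hW
  set P := padeP (k + 1) k with hP
  set Q := padeQ (k + 1) k with hQ
  have h0 : (P * Q).coeff 0 = 1 := by
    rw [mul_coeff_zero, hP, hQ, padeP_coeff_zero, padeQ_coeff_zero, one_mul]
  have h1 : (P * Q).coeff 1 ≠ 0 := by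
    rw [mul_coeff_one, hP, hQ, padeP_coeff_zero, padeQ_coeff_zero,
      padeP_coeff_one (by omega), padeQ_coeff_one (by omega)]
    have : (k : ℝ) + 1 + k ≠ 0 := by positivity
    push_cast
    field_simp
    simpa using this
  have hF0 : aeval (((0 : ℝ) : ℂ) * Complex.I) (P * Q) = 1 := by
    simp only [Complex.ofReal_zero, zero_mul, ← coeff_zero_eq_aeval_zero', h0, map_one]
  have hF : ∀ᶠ ω : ℝ in nhds 0, aeval ((ω : ℂ) * Complex.I) (P * Q) ≠ 0 := by
    have hcont : Continuous fun ω : ℝ => aeval ((ω : ℂ) * Complex.I) (P * Q) := by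
      fun_prop
    exact hcont.continuousAt.eventually_ne (hF0 ▸ one_ne_zero)
  have hτ := hF.mono fun ω hω => groupDelay_div_eq hW h0 hω
  have hH : padeH (k + 1) k = fun z => aeval z Q / aeval z P := rfl
  rw [hH]
  have hmain := iteratedDeriv_of_eventuallyEq_add_pow_mul
    (analyticAt_const.mul (analyticAt_re_aeval_div_aeval (by rw [h0]; exact one_ne_zero)))
    (by
      rw [Pi.mul_apply, hF0, Complex.ofReal_zero, zero_mul, ← coeff_zero_eq_aeval_zero', coeff_divX]
      simpa [hc] using h1) hτ
  refine ⟨?_, fun j hj hj' => hmain.1 j hj (by omega), hmain.2 (by omega)⟩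
  simpa using hτ.self_of_nhds
end

section
/- For all integers m, n, j with 1 ≤ j ≤ m < n, the quantity A_j = [((2n)!)² ((n−j)!)² (m!)² (2(m−j))! (2m−j)!] / [(n!)² (2(n−j))! (2n−j)! ((2m)!)² ((m−j)!)²] satisfies A_j > 1. -/
open Nat

/-- The quantity `A_j` from (12), for integers `1 ≤ j ≤ m < n`. -/
noncomputable def Aval (n m j : ℕ) : ℝ :=
  (((2 * n)! : ℝ) ^ 2 * ((n - j)! : ℝ) ^ 2 * (m ! : ℝ) ^ 2 * ((2 * (m - j))! : ℝ) *
      ((2 * m - j)! : ℝ)) /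
    ((n ! : ℝ) ^ 2 * ((2 * (n - j))! : ℝ) * ((2 * n - j)! : ℝ) * ((2 * m)! : ℝ) ^ 2 *
      ((m - j)! : ℝ) ^ 2)

/-- The `n`-dependent factor of `Aval n m j`, written in terms of `k = n - j`. -/
noncomputable def AvalFactor (j k : ℕ) : ℝ :=
  ((2 * (j + k))! : ℝ) ^ 2 * (k ! : ℝ) ^ 2 /
    (((j + k)! : ℝ) ^ 2 * ((2 * k)! : ℝ) * ((2 * k + j)! : ℝ))

lemma AvalFactor_pos (j k : ℕ) : 0 < AvalFactor j k := by
  unfold AvalFactor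
  positivity

lemma AvalFactor_succ (j k : ℕ) :
    AvalFactor j (k + 1) = AvalFactor j k *
      (2 * (2 * j + 2 * k + 1) ^ 2 * (k + 1) / ((2 * k + 1) * (2 * k + j + 2) * (2 * k + j + 1))) := by
  unfold AvalFactor
  rw [show 2 * (j + (k + 1)) = 2 * (j + k) + 1 + 1 by ring, show j + (k + 1) = j + k + 1 by ring,
    show 2 * (k + 1) + j = 2 * k + j + 1 + 1 by ring, show 2 * (k + 1) = 2 * k + 1 + 1 by ring]
  simp only [Nat.factorial_succ]
  push_cast
  field_simp
  ring

lemma AvalFactor_strictMono {j : ℕ} (hj : 1 ≤ j) : StrictMono (AvalFactor j) := by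
  refine strictMono_nat_of_lt_succ fun k => ?_
  rw [AvalFactor_succ]
  refine lt_mul_of_one_lt_right (AvalFactor_pos j k) ?_
  rw [one_lt_div (by positivity)]
  have hj' : (1 : ℝ) ≤ j := by exact_mod_cast hj
  have hk : (0 : ℝ) ≤ k := k.cast_nonneg
  calc (2 * k + 1 : ℝ) * (2 * k + j + 2) * (2 * k + j + 1)
      = (2 * k + 1) * ((2 * k + j + 2) * (2 * k + j + 1)) := by ring
    _ ≤ (2 * k + 1) * ((2 * j + 2 * k + 1) * (2 * j + 2 * k + 1)) := by
      gcongr ?_ * (?_ * ?_) <;> linarith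
    _ < (2 * (k + 1)) * ((2 * j + 2 * k + 1) * (2 * j + 2 * k + 1)) := by
      gcongr
      linarith
    _ = 2 * (2 * j + 2 * k + 1) ^ 2 * (k + 1) := by ring

lemma Aval_eq_div (j k l : ℕ) :
    Aval (j + k) (j + l) j = AvalFactor j k / AvalFactor j l := by
  unfold Aval AvalFactor
  rw [show 2 * (j + k) - j = 2 * k + j by omega, show 2 * (j + l) - j = 2 * l + j by omega,
    Nat.add_sub_cancel_left, Nat.add_sub_cancel_left]
  field_simp

/-- for integers `1 ≤ j ≤ m < n`, the quantity `A_j` satisfies `A_j > 1`. -/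
theorem Aval_gt_one (n m j : ℕ) (hj : 1 ≤ j) (hjm : j ≤ m) (hmn : m < n) :
    1 < Aval n m j := by
  obtain ⟨l, rfl⟩ := Nat.exists_eq_add_of_le hjm
  obtain ⟨k, rfl⟩ := Nat.exists_eq_add_of_le (hjm.trans hmn.le)
  rw [Aval_eq_div, one_lt_div (AvalFactor_pos j l)]
  exact AvalFactor_strictMono hj (by omega)
end

section
/- For all integers 1 ≤ j ≤ m < n, every real number γ with γ ≠ 1 satisfying (γ/(γ−1))^{2j} = A_j must satisfy γ > 1/2. Consequently only minimum-phase choices of γ can equate a pair of coefficients in the squared-magnitude expansion of Budak's function. -/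
open Nat

/-- The part of `Aval n m j` that depends on `n`, as a function of `d = n - j`; the part that depends
on `m` is its reciprocal at `d = m - j`. -/
noncomputable def factorialRatio (j d : ℕ) : ℝ :=
  (((2 * (j + d))! : ℝ) ^ 2 * (d ! : ℝ) ^ 2) /
    (((j + d)! : ℝ) ^ 2 * ((2 * d)! : ℝ) * ((j + 2 * d)! : ℝ))

theorem factorialRatio_pos (j d : ℕ) : 0 < factorialRatio j d := by
  unfold factorialRatio
  positivity

theorem factorialRatio_succ (j d : ℕ) :
    factorialRatio j (d + 1) = factorialRatio j d *
      ((2 * (j + d) + 1 : ℝ) ^ 2 * (2 * (d + 1)) /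
        ((2 * d + 1) * (j + 2 * d + 2) * (j + 2 * d + 1))) := by
  have h₁ : 2 * (j + (d + 1)) = 2 * (j + d) + 1 + 1 := by ring
  have h₂ : j + (d + 1) = j + d + 1 := by ring
  have h₃ : 2 * (d + 1) = 2 * d + 1 + 1 := by ring
  have h₄ : j + (2 * d + 1 + 1) = j + 2 * d + 1 + 1 := by ring
  unfold factorialRatio
  rw [h₁, h₂, h₃, h₄]
  simp only [Nat.factorial_succ]
  push_cast
  field_simp
  ring

theorem factorialRatio_strictMono {j : ℕ} (hj : 1 ≤ j) : StrictMono (factorialRatio j) := by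
  refine strictMono_nat_of_lt_succ fun d => ?_
  rw [factorialRatio_succ]
  refine lt_mul_of_one_lt_right (factorialRatio_pos j d) ?_
  have hj' : (0 : ℝ) < j := by exact_mod_cast hj
  have hd : (0 : ℝ) ≤ d := d.cast_nonneg
  rw [one_lt_div (by positivity), ← sub_pos]
  ring_nf
  positivity

theorem Aval_eq_factorialRatio_div {n m j : ℕ} (hjm : j ≤ m) (hjn : j ≤ n) :
    Aval n m j = factorialRatio j (n - j) / factorialRatio j (m - j) := by
  obtain ⟨d, rfl⟩ := Nat.exists_eq_add_of_le hjm
  obtain ⟨e, rfl⟩ := Nat.exists_eq_add_of_le hjn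
  have h (x : ℕ) : 2 * (j + x) - j = j + 2 * x := by omega
  unfold Aval factorialRatio
  simp only [Nat.add_sub_cancel_left, h]
  field_simp

theorem one_lt_Aval {n m j : ℕ} (hj : 1 ≤ j) (hjm : j ≤ m) (hmn : m < n) : 1 < Aval n m j := by
  rw [Aval_eq_factorialRatio_div hjm (hjm.trans hmn.le), one_lt_div (factorialRatio_pos _ _)]
  exact factorialRatio_strictMono hj (by omega)

/-- for `1 ≤ j ≤ m < n`, any real `γ ≠ 1` with `(γ/(γ−1))^{2j} = A_j` must
satisfy `γ > 1/2`; hence only minimum-phase choices of `γ` can equate a pair of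
coefficients in the squared-magnitude expansion of Budak's function. -/
theorem gamma_gt_half (n m j : ℕ) (hj : 1 ≤ j) (hjm : j ≤ m) (hmn : m < n)
    (γ : ℝ) (hγ : γ ≠ 1) (heq : (γ / (γ - 1)) ^ (2 * j) = Aval n m j) :
    γ > 1 / 2 := by
  have hA := one_lt_Aval hj hjm hmn
  by_contra! h
  have h₁ : (γ / (γ - 1)) ^ 2 ≤ 1 := by
    rw [div_pow, div_le_one (by have := sub_ne_zero.mpr hγ; positivity)]
    nlinarith
  rw [← heq, pow_mul] at hA
  exact hA.not_ge (pow_le_one₀ (sq_nonneg _) h₁)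
end

section
/- Fix integers 1 ≤ j ≤ m < n and a real γ with γ ≠ 1. Let N(ω) = [(2n)!/(2m)!]² (m!/n!) Σ_{i=0}^{m} C(m,i) ((2i)!/i!) (m+i)! (2(γ−1))^{2(m−i)} ω^{2(m−i)} and D(ω) = Σ_{k=0}^{n} C(n,k) ((2k)!/k!) (n+k)! (2γ)^{2(n−k)} ω^{2(n−k)} be the numerator and denominator polynomials of the squared magnitude of Budak's function. Then the coefficient of ω^{2j} in N equals the coefficient of ω^{2j} in D if and only if (γ/(γ−1))^{2j} = A_j. -/
open Nat

open Polynomial Finset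

/-- Numerator polynomial `N(ω)` of the squared magnitude (11) of Budak's function. -/
noncomputable def budakNum (m n : ℕ) (γ : ℝ) : Polynomial ℝ :=
  Polynomial.C ((((2 * n)! : ℝ) / ((2 * m)! : ℝ)) ^ 2 * ((m ! : ℝ) / (n ! : ℝ))) *
    ∑ i ∈ Finset.range (m + 1),
      Polynomial.C ((m.choose i : ℝ) * (((2 * i)! : ℝ) / (i ! : ℝ)) * ((m + i)! : ℝ) *
          (2 * (γ - 1)) ^ (2 * (m - i))) *
        Polynomial.X ^ (2 * (m - i))

/-- Denominator polynomial `D(ω)` of the squared magnitude (11) of Budak's function. -/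
noncomputable def budakDen (n : ℕ) (γ : ℝ) : Polynomial ℝ :=
  ∑ k ∈ Finset.range (n + 1),
    Polynomial.C ((n.choose k : ℝ) * (((2 * k)! : ℝ) / (k ! : ℝ)) * ((n + k)! : ℝ) *
        (2 * γ) ^ (2 * (n - k))) *
      Polynomial.X ^ (2 * (n - k))

/-- The coefficient of `X ^ (2 * j)` in an even polynomial whose terms are indexed by codegree. -/
lemma coeff_sum_C_mul_X_pow_two_mul_sub {R : Type*} [Semiring R] (f : ℕ → R) {r j : ℕ}
    (h : j ≤ r) :
    (∑ i ∈ Finset.range (r + 1),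
      Polynomial.C (f i) * Polynomial.X ^ (2 * (r - i))).coeff (2 * j) = f (r - j) := by
  simp only [Polynomial.finsetSum_coeff, Polynomial.coeff_C_mul_X_pow]
  rw [Finset.sum_eq_single_of_mem (r - j) (Finset.mem_range.2 (by lia))]
  · rw [if_pos (by lia)]
  · intro i hi hne
    rw [Finset.mem_range] at hi
    rw [if_neg (by lia)]

/-- for `1 ≤ j ≤ m < n` and real `γ ≠ 1`, the coefficient of `ω^{2j}` in
`N` equals the coefficient of `ω^{2j}` in `D` if and only if `(γ/(γ−1))^{2j} = A_j`. -/
theorem budak_coeff_eq_iff (n m j : ℕ) (hj : 1 ≤ j) (hjm : j ≤ m) (hmn : m < n)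
    (γ : ℝ) (hγ : γ ≠ 1) :
    (budakNum m n γ).coeff (2 * j) = (budakDen n γ).coeff (2 * j) ↔
      (γ / (γ - 1)) ^ (2 * j) = Aval n m j := by
  have hγ' : γ - 1 ≠ 0 := sub_ne_zero.2 hγ
  have hjn : j ≤ n := by lia
  rw [budakNum, budakDen, Polynomial.coeff_C_mul, coeff_sum_C_mul_X_pow_two_mul_sub _ hjm,
    coeff_sum_C_mul_X_pow_two_mul_sub _ hjn, Nat.sub_sub_self hjm, Nat.sub_sub_self hjn,
    Nat.choose_symm hjm, Nat.choose_symm hjn, Nat.cast_choose ℝ hjm, Nat.cast_choose ℝ hjn,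
    show m + (m - j) = 2 * m - j by lia, show n + (n - j) = 2 * n - j by lia, Aval,
    mul_pow, mul_pow, div_pow γ]
  have hpow : (γ - 1) ^ (2 * j) ≠ 0 := pow_ne_zero _ hγ'
  have htwo : (2 : ℝ) ^ (2 * j) ≠ 0 := by positivity
  generalize (γ - 1) ^ (2 * j) = x at *
  generalize γ ^ (2 * j) = y at *
  generalize (2 : ℝ) ^ (2 * j) = t at *
  field_simp
  constructor <;> intro h <;> linarith
end
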